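/- arXiv:1606.06707 — 2 statements merged into one kernel-verified Lean document; each statement's English description precedes it below -/
import Mathlib

section
/- Fix P ≥ 0 and integers 1 ≤ n ≤ T and 0 ≤ m < n. Then the value function satisfies the Bellman equation V_P(n,m) = min over d ∈ Δ of B(d), where B(d) = C·FP(d) + V_P(n+1, m+1) if d > m; B(d) = C·FP(d) + V_P(n+1, d) if d ≤ m and Σ_{k=n−m}^{n} D(k) ≤ P; and B(d) = ⊤ otherwise (all computations in WithTop ℝ, with ⊤ absorbing under addition). -/
namespace IDS

/-- `(n,m,P)`-feasibility of a suffix schedule `δ` on `{n,…,T}`. -/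
def FeasibleSuffix (T : ℕ) (D : ℕ → ℝ) (P : ℝ) (n m : ℕ) (δ : ℕ → ℕ) : Prop :=
  ∀ ka ∈ Finset.Icc (n - m) T,
    (∃ k ∈ Finset.Icc (max ka n) T, δ k ≤ k - ka) →
      (∑ k ∈ Finset.Icc ka (sInf {k | max ka n ≤ k ∧ k ≤ T ∧ δ k ≤ k - ka}), D k) ≤ P

end IDS

namespace IDS

/-- Feasibility phrased through an explicit first detection time `σ`. -/
theorem feasibleSuffix_iff {T : ℕ} {D : ℕ → ℝ} {P : ℝ} {n m : ℕ} {δ : ℕ → ℕ} :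
    FeasibleSuffix T D P n m δ ↔
      ∀ ka σ, n - m ≤ ka → ka ≤ σ → n ≤ σ → σ ≤ T → δ σ ≤ σ - ka →
        (∀ k, ka ≤ k → n ≤ k → k < σ → k - ka < δ k) → ∑ k ∈ Finset.Icc ka σ, D k ≤ P := by
  constructor
  · intro h ka σ hnm hka hn hT hd hmin
    have hσ : sInf {k | max ka n ≤ k ∧ k ≤ T ∧ δ k ≤ k - ka} = σ := by
      refine IsLeast.csInf_eq ⟨⟨max_le hka hn, hT, hd⟩, ?_⟩
      rintro k ⟨hk, -, hdk⟩
      by_contra! hlt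
      have := hmin k (le_of_max_le_left hk) (le_of_max_le_right hk) hlt
      omega
    have := h ka (Finset.mem_Icc.2 ⟨hnm, hka.trans hT⟩)
      ⟨σ, Finset.mem_Icc.2 ⟨max_le hka hn, hT⟩, hd⟩
    rwa [hσ] at this
  · rintro h ka hka ⟨k, hk, hd⟩
    rw [Finset.mem_Icc] at hka hk
    have hmem : sInf {k | max ka n ≤ k ∧ k ≤ T ∧ δ k ≤ k - ka} ∈
        {k | max ka n ≤ k ∧ k ≤ T ∧ δ k ≤ k - ka} := Nat.sInf_mem ⟨k, hk.1, hk.2, hd⟩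
    obtain ⟨h1, h2, h3⟩ := hmem
    refine h ka _ hka.1 (le_of_max_le_left h1) (le_of_max_le_right h1) h2 h3 ?_
    intro j hj hnj hjlt
    by_contra! hle
    exact Nat.notMem_of_lt_sInf hjlt ⟨max_le hj hnj, hjlt.le.trans h2, hle⟩

/-- Feasibility only depends on the values of the schedule from time `n` on. -/
theorem FeasibleSuffix.congr {T : ℕ} {D : ℕ → ℝ} {P : ℝ} {n m : ℕ} {δ δ' : ℕ → ℕ}
    (h : FeasibleSuffix T D P n m δ) (hδ : ∀ k, n ≤ k → δ' k = δ k) :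
    FeasibleSuffix T D P n m δ' := by
  rw [feasibleSuffix_iff] at h ⊢
  intro ka σ hnm hka hn hT hd hmin
  refine h ka σ hnm hka hn hT (hδ σ hn ▸ hd) fun k hk hnk hlt => ?_
  rw [← hδ k hnk]
  exact hmin k hk hnk hlt

theorem feasibleSuffix_succ_iff_of_lt {T : ℕ} {D : ℕ → ℝ} {P : ℝ} {n m : ℕ} {δ : ℕ → ℕ}
    (hd : m < δ n) :
    FeasibleSuffix T D P n m δ ↔ FeasibleSuffix T D P (n + 1) (m + 1) δ := by
  rw [feasibleSuffix_iff, feasibleSuffix_iff]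
  constructor
  · intro h ka σ hnm hka hn hT hdσ hmin
    refine h ka σ (by omega) hka (by omega) hT hdσ fun k hk hnk hlt => ?_
    rcases hnk.eq_or_lt with rfl | hlt'
    · omega
    · exact hmin k hk hlt' hlt
  · intro h ka σ hnm hka hn hT hdσ hmin
    rcases hn.eq_or_lt with rfl | hlt'
    · omega
    · exact h ka σ (by omega) hka hlt' hT hdσ fun k hk hnk hlt => hmin k hk (by omega) hlt

theorem feasibleSuffix_succ_iff_of_le {T : ℕ} {D : ℕ → ℝ} (hD : ∀ k, 0 ≤ D k) {P : ℝ}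
    {n m : ℕ} {δ : ℕ → ℕ} (hnT : n ≤ T) (hm : m < n) (hd : δ n ≤ m) :
    FeasibleSuffix T D P n m δ ↔
      ∑ k ∈ Finset.Icc (n - m) n, D k ≤ P ∧ FeasibleSuffix T D P (n + 1) (δ n) δ := by
  rw [feasibleSuffix_iff, feasibleSuffix_iff]
  constructor
  · intro h
    refine ⟨h (n - m) n le_rfl (by omega) le_rfl hnT (by omega) fun k _ _ _ => by omega, ?_⟩
    intro ka σ hnm hka hn hT hdσ hmin
    refine h ka σ (by omega) hka (by omega) hT hdσ fun k hk hnk hlt => ?_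
    rcases hnk.eq_or_lt with rfl | hlt'
    · omega
    · exact hmin k hk hlt' hlt
  · rintro ⟨hsum, h⟩ ka σ hnm hka hn hT hdσ hmin
    rcases hn.eq_or_lt with rfl | hlt'
    · exact (Finset.sum_le_sum_of_subset_of_nonneg (Finset.Icc_subset_Icc_left hnm)
        fun k _ _ => hD k).trans hsum
    · refine h ka σ ?_ hka hlt' hT hdσ fun k hk hnk hlt => hmin k hk (by omega) hlt
      by_contra! hlt
      have := hmin n (by omega) le_rfl hlt'
      omega

end IDS

/-- A bound on all translates `a + r` of real elements passes to the translate of the infimum. -/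
theorem WithTop.le_coe_add_of_isGLB {S : Set (WithTop ℝ)} {y : WithTop ℝ} (hy : IsGLB S y)
    (hS : ∀ s ∈ S, s ≠ ⊤) {x : WithTop ℝ} {a : ℝ} (h : ∀ s ∈ S, x ≤ (a : WithTop ℝ) + s) :
    x ≤ (a : WithTop ℝ) + y := by
  induction x with
  | top =>
    have hy_top : ⊤ ≤ y := hy.2 fun s hs => by
      have := h s hs
      rw [top_le_iff, WithTop.add_eq_top] at this
      exact absurd (this.resolve_left WithTop.coe_ne_top) (hS s hs)
    rw [top_le_iff.1 hy_top, WithTop.add_top]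
  | coe r =>
    have hr : ((r - a : ℝ) : WithTop ℝ) ≤ y := hy.2 fun s hs => by
      have h1 := h s hs
      lift s to ℝ using hS s hs
      rw [← WithTop.coe_add, WithTop.coe_le_coe] at h1
      exact WithTop.coe_le_coe.2 (by linarith)
    calc (r : WithTop ℝ) = (a : WithTop ℝ) + ((r - a : ℝ) : WithTop ℝ) := by
          rw [← WithTop.coe_add, add_sub_cancel]
      _ ≤ (a : WithTop ℝ) + y := by gcongr

/-- Bellman equation for the value function
`V_P(n,m) = inf { C·∑_{k=n}^{T} FP (δ k) : δ an (n,m,P)-feasible suffix schedule }`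
(`⊤` if none exists), computed in `WithTop ℝ`:
`V_P(n,m) = min_{d ∈ Δ} B d`, where
`B d = C·FP d + V_P(n+1,m+1)` if `d > m`;
`B d = C·FP d + V_P(n+1,d)` if `d ≤ m` and `∑_{k=n−m}^{n} D k ≤ P`;
`B d = ⊤` otherwise. -/
theorem value_function_bellman
    (T : ℕ) (hT : 1 ≤ T)
    (D : ℕ → ℝ) (hD : ∀ k, 0 ≤ D k) (hD0 : D 0 = 0) (hDT : ∀ k, T < k → D k = 0)
    (Δ : Finset ℕ) (hΔ : Δ.Nonempty)
    (FP : ℕ → ℝ) (hFP : ∀ d, 0 ≤ FP d)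
    (C : ℝ) (hC : 0 < C)
    (P : ℝ) (hP : 0 ≤ P)
    (V : ℕ → ℕ → WithTop ℝ)
    (hV : ∀ n m : ℕ, m < n →
      V n m = sInf {x : WithTop ℝ | ∃ δ : ℕ → ℕ,
        (∀ k ∈ Finset.Icc n T, δ k ∈ Δ) ∧
        IDS.FeasibleSuffix T D P n m δ ∧
        x = ((C * ∑ k ∈ Finset.Icc n T, FP (δ k) : ℝ) : WithTop ℝ)})
    (n m : ℕ) (hn1 : 1 ≤ n) (hnT : n ≤ T) (hm : m < n) :
    V n m = Δ.inf' hΔ (fun d =>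
      if m < d then ((C * FP d : ℝ) : WithTop ℝ) + V (n + 1) (m + 1)
      else if (∑ k ∈ Finset.Icc (n - m) n, D k) ≤ P then
        ((C * FP d : ℝ) : WithTop ℝ) + V (n + 1) d
      else ⊤) := by
  have hGLB : ∀ n m : ℕ, m < n → IsGLB {x : WithTop ℝ | ∃ δ : ℕ → ℕ,
      (∀ k ∈ Finset.Icc n T, δ k ∈ Δ) ∧ IDS.FeasibleSuffix T D P n m δ ∧
      x = ((C * ∑ k ∈ Finset.Icc n T, FP (δ k) : ℝ) : WithTop ℝ)} (V n m) := by
    intro n m hm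
    rw [hV n m hm]
    refine WithTop.isGLB_sInf' ⟨((0 : ℝ) : WithTop ℝ), ?_⟩
    rintro x ⟨δ, -, -, rfl⟩
    exact WithTop.coe_le_coe.2 (mul_nonneg hC.le (Finset.sum_nonneg fun k _ => hFP _))
  have hcost : ∀ δ : ℕ → ℕ, ((C * ∑ k ∈ Finset.Icc n T, FP (δ k) : ℝ) : WithTop ℝ) =
      ((C * FP (δ n) : ℝ) : WithTop ℝ) +
        ((C * ∑ k ∈ Finset.Icc (n + 1) T, FP (δ k) : ℝ) : WithTop ℝ) := by
    intro δ
    rw [← WithTop.coe_add, ← mul_add, ← Finset.insert_Icc_succ_left_eq_Icc hnT,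
      Finset.sum_insert (by simp)]
    rfl
  have hext : ∀ d ∈ Δ, ∀ m' < n + 1,
      (∀ δ : ℕ → ℕ, δ n = d → IDS.FeasibleSuffix T D P (n + 1) m' δ →
        IDS.FeasibleSuffix T D P n m δ) →
      V n m ≤ ((C * FP d : ℝ) : WithTop ℝ) + V (n + 1) m' := by
    intro d hd m' hm' hfeas
    refine WithTop.le_coe_add_of_isGLB (hGLB (n + 1) m' hm') ?_ ?_
    · rintro s ⟨δ, -, -, rfl⟩
      exact WithTop.coe_ne_top
    · rintro s ⟨δ, hδ, hδf, rfl⟩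
      have heq : ∀ k, n + 1 ≤ k → Function.update δ n d k = δ k := fun k hk =>
        Function.update_of_ne (by omega) _ _
      refine (hGLB n m hm).1 ⟨Function.update δ n d, ?_, ?_, ?_⟩
      · intro k hk
        rw [Finset.mem_Icc] at hk
        rcases hk.1.eq_or_lt with rfl | hlt
        · simpa using hd
        · rw [heq k hlt]
          exact hδ k (Finset.mem_Icc.2 ⟨hlt, hk.2⟩)
      · exact hfeas _ (Function.update_self ..) (hδf.congr heq)
      · rw [hcost, Function.update_self,
          Finset.sum_congr rfl fun k hk => congrArg FP (heq k (Finset.mem_Icc.1 hk).1)]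
  apply le_antisymm
  · refine Finset.le_inf' _ _ fun d hd => ?_
    split_ifs with hmd hsum
    · exact hext d hd (m + 1) (by omega) fun δ hδ =>
        (IDS.feasibleSuffix_succ_iff_of_lt (hδ ▸ hmd)).2
    · refine hext d hd d (by omega) fun δ hδ hf => ?_
      subst hδ
      exact (IDS.feasibleSuffix_succ_iff_of_le hD hnT hm (not_lt.1 hmd)).2 ⟨hsum, hf⟩
    · exact le_top
  · refine (hGLB n m hm).2 ?_
    rintro x ⟨δ, hδ, hδf, rfl⟩
    have hδ' : ∀ k ∈ Finset.Icc (n + 1) T, δ k ∈ Δ := fun k hk =>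
      hδ k (Finset.Icc_subset_Icc_left n.le_succ hk)
    refine (Finset.inf'_le _ (hδ n (Finset.mem_Icc.2 ⟨le_rfl, hnT⟩))).trans ?_
    rw [hcost]
    by_cases hmd : m < δ n
    · rw [if_pos hmd]
      gcongr
      exact (hGLB (n + 1) (m + 1) (by omega)).1
        ⟨δ, hδ', (IDS.feasibleSuffix_succ_iff_of_lt hmd).1 hδf, rfl⟩
    · obtain ⟨hsum, hf⟩ :=
        (IDS.feasibleSuffix_succ_iff_of_le hD hnT hm (not_lt.1 hmd)).1 hδf
      rw [if_neg hmd, if_pos hsum]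
      gcongr
      exact (hGLB (n + 1) (δ n) (by omega)).1 ⟨δ, hδ', hf, rfl⟩
end

section
/- Suppose P* ∈ SearchSpace ∪ {0} minimizes TC(P) + P in WithTop ℝ over P ∈ SearchSpace ∪ {0}, TC(P*) ≠ ⊤, and δ* is a schedule with maxDamage(δ*) ≤ P* and Cost(δ*) equal to TC(P*). Then δ* is an optimal adaptive threshold: Loss(δ*) ≤ Loss(δ) for every adaptive threshold schedule δ : {1,...,T} → Δ. -/
namespace IDS

/-- The attack starting at `ka` is detected by the schedule `δ` on horizon `{1,…,T}`. -/
def detects (T : ℕ) (δ : ℕ → ℕ) (ka : ℕ) : Prop :=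
  ∃ k ∈ Finset.Icc ka T, δ k ≤ k - ka

/-- Detection time: the least `k ∈ {ka,…,T}` with `δ k ≤ k - ka`. -/
noncomputable def detTime (T : ℕ) (δ : ℕ → ℕ) (ka : ℕ) : ℕ :=
  sInf {k | ka ≤ k ∧ k ≤ T ∧ δ k ≤ k - ka}

/-- Attacker's payoff: total damage up to the detection time. -/
noncomputable def payoff (T : ℕ) (D : ℕ → ℝ) (δ : ℕ → ℕ) (ka : ℕ) : ℝ :=
  ∑ k ∈ Finset.Icc ka (detTime T δ ka), D k

open Classical in
/-- Worst-case damage: maximum payoff over detected attack starts, `0` if none. -/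
noncomputable def maxDamage (T : ℕ) (D : ℕ → ℝ) (δ : ℕ → ℕ) : ℝ :=
  if h : ((Finset.Icc 1 T).filter (fun ka => detects T δ ka)).Nonempty then
    ((Finset.Icc 1 T).filter (fun ka => detects T δ ka)).sup' h (payoff T D δ)
  else 0

/-- Number of threshold changes `N(δ) = |{k ∈ {1,…,T−1} : δ k ≠ δ (k+1)}|`. -/
def numChanges (T : ℕ) (δ : ℕ → ℕ) : ℕ :=
  ((Finset.Icc 1 (T - 1)).filter (fun k => δ k ≠ δ (k + 1))).card

/-- Defender's cost: `C_d·N(δ) + C·∑_{k=1}^{T} FP (δ k)`. -/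
noncomputable def defCost (T : ℕ) (C Cd : ℝ) (FP : ℕ → ℝ) (δ : ℕ → ℕ) : ℝ :=
  Cd * (numChanges T δ : ℝ) + C * ∑ k ∈ Finset.Icc 1 T, FP (δ k)

/-- Defender's loss: `Cost(δ) + maxDamage(δ)`. -/
noncomputable def defLoss (T : ℕ) (D : ℕ → ℝ) (C Cd : ℝ) (FP : ℕ → ℝ) (δ : ℕ → ℕ) : ℝ :=
  defCost T C Cd FP δ + maxDamage T D δ

end IDS

namespace IDS

lemma maxDamage_mem (T : ℕ) (D : ℕ → ℝ) (δ : ℕ → ℕ) :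
    maxDamage T D δ ∈ insert (0 : ℝ)
      (((Finset.Icc 1 T ×ˢ Finset.Icc 1 T).filter (fun ab => ab.1 ≤ ab.2)).image
        (fun ab => ∑ k ∈ Finset.Icc ab.1 ab.2, D k)) := by
  classical
  unfold maxDamage
  split_ifs with h
  · obtain ⟨ka, hka, heq⟩ := Finset.exists_mem_eq_sup' h (payoff T D δ)
    rw [heq]
    obtain ⟨hkaT, k, hk, hdet⟩ := Finset.mem_filter.mp hka
    have hmem : detTime T δ ka ∈ {k | ka ≤ k ∧ k ≤ T ∧ δ k ≤ k - ka} :=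
      Nat.sInf_mem ⟨k, (Finset.mem_Icc.mp hk).1, (Finset.mem_Icc.mp hk).2, hdet⟩
    obtain ⟨hle, hleT, -⟩ := hmem
    have hka1 := (Finset.mem_Icc.mp hkaT).1
    refine Finset.mem_insert_of_mem (Finset.mem_image.mpr ⟨(ka, detTime T δ ka), ?_, rfl⟩)
    simp only [Finset.mem_filter, Finset.mem_product, Finset.mem_Icc]
    omega
  · exact Finset.mem_insert_self _ _

lemma defCost_nonneg (T : ℕ) {C Cd : ℝ} {FP : ℕ → ℝ} (hC : 0 ≤ C) (hCd : 0 ≤ Cd)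
    (hFP : ∀ d, 0 ≤ FP d) (δ : ℕ → ℕ) : 0 ≤ defCost T C Cd FP δ :=
  add_nonneg (mul_nonneg hCd (Nat.cast_nonneg _))
    (mul_nonneg hC (Finset.sum_nonneg fun _ _ => hFP _))

end IDS

/-- If `P* ∈ SearchSpace ∪ {0}` minimizes `TC P + P` over
`P ∈ SearchSpace ∪ {0}` (in `WithTop ℝ`), `TC P* ≠ ⊤`, and `δ*` is a schedule with
`maxDamage δ* ≤ P*` and `↑(Cost δ*) = TC P*`, then `δ*` is an optimal adaptive
threshold: `Loss δ* ≤ Loss δ` for every schedule `δ : {1,…,T} → Δ`. -/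
theorem minimizer_of_TC_add_damage_is_optimal
    (T : ℕ) (hT : 1 ≤ T)
    (D : ℕ → ℝ) (hD : ∀ k, 0 ≤ D k) (hD0 : D 0 = 0) (hDT : ∀ k, T < k → D k = 0)
    (Δ : Finset ℕ) (hΔ : Δ.Nonempty)
    (FP : ℕ → ℝ) (hFP : ∀ d, 0 ≤ FP d)
    (C : ℝ) (hC : 0 < C) (Cd : ℝ) (hCd : 0 ≤ Cd)
    (SearchSpace : Finset ℝ)
    (hS : SearchSpace =
      ((Finset.Icc 1 T ×ˢ Finset.Icc 1 T).filter (fun ab => ab.1 ≤ ab.2)).image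
        (fun ab => ∑ k ∈ Finset.Icc ab.1 ab.2, D k))
    (TC : ℝ → WithTop ℝ)
    (hTC : ∀ P : ℝ,
      TC P = sInf {x : WithTop ℝ | ∃ δ : ℕ → ℕ,
        (∀ k ∈ Finset.Icc 1 T, δ k ∈ Δ) ∧
        IDS.maxDamage T D δ ≤ P ∧
        x = ((IDS.defCost T C Cd FP δ : ℝ) : WithTop ℝ)})
    (Pstar : ℝ) (hPmem : Pstar ∈ insert (0 : ℝ) SearchSpace)
    (hPmin : ∀ P ∈ insert (0 : ℝ) SearchSpace,
      TC Pstar + ((Pstar : ℝ) : WithTop ℝ) ≤ TC P + ((P : ℝ) : WithTop ℝ))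
    (hTCne : TC Pstar ≠ ⊤)
    (δstar : ℕ → ℕ) (hδstar : ∀ k ∈ Finset.Icc 1 T, δstar k ∈ Δ)
    (hdam : IDS.maxDamage T D δstar ≤ Pstar)
    (hcost : ((IDS.defCost T C Cd FP δstar : ℝ) : WithTop ℝ) = TC Pstar) :
    ∀ δ : ℕ → ℕ, (∀ k ∈ Finset.Icc 1 T, δ k ∈ Δ) →
      IDS.defLoss T D C Cd FP δstar ≤ IDS.defLoss T D C Cd FP δ := by
  intro δ hδ
  subst hS
  have hmin := hPmin _ (IDS.maxDamage_mem T D δ)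
  have hTCle : TC (IDS.maxDamage T D δ) ≤ ((IDS.defCost T C Cd FP δ : ℝ) : WithTop ℝ) := by
    rw [hTC]
    refine csInf_le ⟨((0 : ℝ) : WithTop ℝ), ?_⟩ ⟨δ, hδ, le_rfl, rfl⟩
    rintro _ ⟨δ', -, -, rfl⟩
    exact WithTop.coe_le_coe.mpr (IDS.defCost_nonneg T hC.le hCd hFP δ')
  have hle := hmin.trans (add_le_add_left hTCle _)
  rw [← hcost, ← WithTop.coe_add, ← WithTop.coe_add, WithTop.coe_le_coe] at hle
  exact (add_le_add_right hdam _).trans hle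
end
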